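/- arXiv:1512.02171 — 4 statements merged into one kernel-verified Lean document; each statement's English description precedes it below -/
import Mathlib

section
/- Let bₙ denote the total number of basis permutations of length n, i.e., bₙ = Σₚ b_{n,p}. Then b₀ = b₁ = 0, b₂ = 1, and for all n ≥ 1, b_{n+2} = 2n·b_{n+1} + (1 + n − n²)·bₙ. -/
/-- The word `σ₁σ₂…σₙ` of a permutation of `{1,…,n}` (0-indexed). -/
def permWord {n : ℕ} (σ : Equiv.Perm (Fin n)) : List (Fin n) :=
  List.ofFn (fun i => σ i)

/-- `β` is obtained from `α` by one right-jump: one entry is removed and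
reinserted at a strictly later position. -/
def RightJump {n : ℕ} (α β : Equiv.Perm (Fin n)) : Prop :=
  ∃ (l₁ l₂ l₃ : List (Fin n)) (a : Fin n), l₂ ≠ [] ∧
    permWord α = l₁ ++ a :: (l₂ ++ l₃) ∧
    permWord β = l₁ ++ (l₂ ++ a :: l₃)

/-- `ReachIn p α β` : `β` is obtained from `α` by a sequence of exactly `p` right-jumps. -/
def ReachIn {n : ℕ} : ℕ → Equiv.Perm (Fin n) → Equiv.Perm (Fin n) → Prop
  | 0, α, β => α = β
  | p + 1, α, β => ∃ γ, RightJump α γ ∧ ReachIn p γ β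

/-- `σᵢ` is a left-to-right maximum of `σ`. -/
def IsLtrMax {n : ℕ} (σ : Equiv.Perm (Fin n)) (i : Fin n) : Prop :=
  ∀ j, j ≤ i → σ j ≤ σ i

/-- The number of non-left-to-right-maxima of `σ`. -/
noncomputable def nonLtrMaxCount {n : ℕ} (σ : Equiv.Perm (Fin n)) : ℕ :=
  {i : Fin n | ¬ IsLtrMax σ i}.ncard

/-- `π` is a pattern of `σ` (`π ≺ σ`): `σ` has a subsequence order-isomorphic to `π`. -/
def IsPattern {k n : ℕ} (π : Equiv.Perm (Fin k)) (σ : Equiv.Perm (Fin n)) : Prop :=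
  ∃ f : Fin k → Fin n, StrictMono f ∧ ∀ i j : Fin k, π i < π j ↔ σ (f i) < σ (f j)

/-- `σ ∈ Cₚ` : `σ` is obtainable from the identity by at most `p` right-jumps. -/
def InC (p : ℕ) {n : ℕ} (σ : Equiv.Perm (Fin n)) : Prop :=
  ∃ q ≤ p, ReachIn q 1 σ

/-- `σ ∈ Bₚ`, the basis of `Cₚ`: `σ ∉ Cₚ` and every pattern `π ≺ σ` with `π ≠ σ`
(equivalently, of length `≠ n`) belongs to `Cₚ`. -/
def InBasis (p : ℕ) {n : ℕ} (σ : Equiv.Perm (Fin n)) : Prop :=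
  ¬ InC p σ ∧ ∀ (k : ℕ) (π : Equiv.Perm (Fin k)), IsPattern π σ → k ≠ n → InC p π

/-- `b_{n,p}`: the number of basis permutations of length `n` in `Bₚ`. -/
noncomputable def bnp (n p : ℕ) : ℕ :=
  Nat.card {σ : Equiv.Perm (Fin n) // InBasis p σ}

/-- `bₙ = Σₚ b_{n,p}`, the total number of basis permutations of length `n`
(the sum is finite: `b_{n,p} = 0` for `p ≥ n`). -/
noncomputable def bTotal (n : ℕ) : ℕ := ∑ p ∈ Finset.range (n + 1), bnp n p


/-- `i` is served. -/
def Served {n : ℕ} (σ : Equiv.Perm (Fin n)) (i : Fin n) : Prop :=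
  ∃ t, i < t ∧ σ t < σ i ∧ ∀ j, j < t → σ t < σ j → j = i

def Good {n : ℕ} (σ : Equiv.Perm (Fin n)) : Prop :=
  ∀ i, IsLtrMax σ i → Served σ i

def EarlyOk {m : ℕ} (σ : Equiv.Perm (Fin (m+1))) : Prop :=
  ∀ i, IsLtrMax σ i → σ i ≠ Fin.last m → Served σ i

def TopOk {m : ℕ} (σ : Equiv.Perm (Fin (m+1))) : Prop :=
  ∀ i, σ i = Fin.last m → Served σ i

lemma good_iff {m : ℕ} (σ : Equiv.Perm (Fin (m+1))) : Good σ ↔ EarlyOk σ ∧ TopOk σ := by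
  constructor
  · intro h
    refine ⟨fun i hi _ => h i hi, fun i hi => h i ?_⟩
    intro j _
    rw [hi]; exact Fin.le_last _
  · rintro ⟨h1, h2⟩ i hi
    by_cases h : σ i = Fin.last m
    · exact h2 i h
    · exact h1 i hi h

/-! ### appending -/

noncomputable def app {n : ℕ} (σ : Equiv.Perm (Fin n)) (v : Fin (n+1)) : Equiv.Perm (Fin (n+1)) :=
  (finSuccEquivLast.trans (Equiv.optionCongr σ)).trans (finSuccEquiv' v).symm

lemma app_castSucc {n : ℕ} (σ : Equiv.Perm (Fin n)) (v : Fin (n+1)) (i : Fin n) :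
    app σ v i.castSucc = v.succAbove (σ i) := by
  simp [app]

lemma app_last {n : ℕ} (σ : Equiv.Perm (Fin n)) (v : Fin (n+1)) :
    app σ v (Fin.last n) = v := by
  simp [app]

lemma app_bij (n : ℕ) : Function.Bijective
    (fun x : Equiv.Perm (Fin n) × Fin (n+1) => app x.1 x.2) := by
  rw [Fintype.bijective_iff_injective_and_card]
  constructor
  · rintro ⟨σ, v⟩ ⟨τ, w⟩ h
    have h : app σ v = app τ w := h
    have hv : v = w := by rw [← app_last σ v, h, app_last]
    subst hv
    congr 1
    ext i
    have := app_castSucc σ v i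
    rw [h, app_castSucc] at this
    rw [Fin.succAbove_right_injective this]
  · simp [Fintype.card_perm, Nat.factorial_succ, mul_comm]

lemma ltr_castSucc {n : ℕ} (σ : Equiv.Perm (Fin n)) (v : Fin (n+1)) (i : Fin n) :
    IsLtrMax (app σ v) i.castSucc ↔ IsLtrMax σ i := by
  constructor
  · intro h j hj
    have := h j.castSucc (by simpa using hj)
    rwa [app_castSucc, app_castSucc, Fin.succAbove_le_succAbove_iff] at this
  · intro h j
    induction j using Fin.lastCases with
    | last => intro hj; exact absurd hj (by simp)
    | cast j =>
      intro hj
      rw [app_castSucc, app_castSucc, Fin.succAbove_le_succAbove_iff]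
      exact h j (by simpa using hj)

lemma ltr_last {n : ℕ} (σ : Equiv.Perm (Fin n)) (v : Fin (n+1)) :
    IsLtrMax (app σ v) (Fin.last n) ↔ v = Fin.last n := by
  constructor
  · intro h
    have := h ((app σ v).symm (Fin.last n)) (Fin.le_last _)
    rw [Equiv.apply_symm_apply, app_last] at this
    exact le_antisymm (Fin.le_last _) this
  · rintro rfl j _
    rw [app_last]; exact Fin.le_last _

lemma not_served_last {n : ℕ} (σ : Equiv.Perm (Fin (n+1))) :
    ¬ Served σ (Fin.last n) := by
  rintro ⟨t, ht, _⟩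
  exact absurd ht (by simp [Fin.le_last])

lemma served_castSucc {m : ℕ} (σ : Equiv.Perm (Fin (m+1))) (v : Fin (m+2)) (i : Fin (m+1)) :
    Served (app σ v) i.castSucc ↔
      Served σ i ∨ (σ i = Fin.last m ∧ v = (Fin.last m).castSucc) := by
  constructor
  · rintro ⟨t, h1, h2, h3⟩
    induction t using Fin.lastCases with
    | last =>
      right
      rw [app_last, app_castSucc, Fin.lt_succAbove_iff_le_castSucc] at h2
      have key : ∀ k : Fin (m+1), v ≤ k.castSucc → k = σ i := by
        intro k hk
        have := h3 (σ.symm k).castSucc (Fin.castSucc_lt_last _) (by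
          rw [app_last, app_castSucc, Fin.lt_succAbove_iff_le_castSucc]; simpa using hk)
        rw [← Fin.castSucc_injective _ this]; simp
      have hl := key (Fin.last m) (h2.trans (by simpa using Fin.le_last _))
      refine ⟨hl.symm, ?_⟩
      rw [← hl] at h2 key
      refine le_antisymm h2 ?_
      by_contra hlt
      push Not at hlt
      have hv : v ≠ Fin.last (m+1) := by
        rintro rfl
        exact absurd hlt (by simp [Fin.le_last])
      have := key (v.castPred hv) (by simp)
      rw [← this] at hlt
      simp at hlt
    | cast t =>
      left
      refine ⟨t, by simpa using h1, ?_, ?_⟩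
      · rwa [app_castSucc, app_castSucc, Fin.succAbove_lt_succAbove_iff] at h2
      · intro j hj hlt
        have := h3 j.castSucc (by simpa using hj) (by
          rwa [app_castSucc, app_castSucc, Fin.succAbove_lt_succAbove_iff])
        exact Fin.castSucc_injective _ this
  · rintro (⟨t, h1, h2, h3⟩ | ⟨h1, rfl⟩)
    · refine ⟨t.castSucc, by simpa using h1, ?_, ?_⟩
      · rwa [app_castSucc, app_castSucc, Fin.succAbove_lt_succAbove_iff]
      · intro j
        induction j using Fin.lastCases with
        | last => intro hj; exact absurd hj (by simp [Fin.le_last])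
        | cast j =>
          intro hj hlt
          rw [app_castSucc, app_castSucc, Fin.succAbove_lt_succAbove_iff] at hlt
          rw [h3 j (by simpa using hj) hlt]
    · refine ⟨Fin.last _, Fin.castSucc_lt_last _, ?_, ?_⟩
      · rw [app_last, app_castSucc, Fin.lt_succAbove_iff_le_castSucc, h1]
      · intro j
        induction j using Fin.lastCases with
        | last => intro hj; exact absurd hj (by simp)
        | cast j =>
          intro _ hlt
          rw [app_last, app_castSucc, Fin.lt_succAbove_iff_le_castSucc] at hlt
          congr 1
          apply σ.injective
          rw [h1]
          exact le_antisymm (Fin.le_last _) (by simpa using hlt)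

lemma succAbove_last_aux {m : ℕ} (v : Fin (m+2)) (hv : v ≠ Fin.last _) :
    v.succAbove (Fin.last m) = Fin.last (m+1) := by
  have h : v ≤ (Fin.last m).castSucc := by
    have h1 := Fin.val_lt_last hv
    rw [Fin.le_def]
    simp only [Fin.val_castSucc, Fin.val_last]
    omega
  rw [Fin.succAbove_of_le_castSucc _ _ h, Fin.succ_last]

lemma succAbove_eq_last {m : ℕ} (v : Fin (m+2)) (hv : v ≠ Fin.last _) (k : Fin (m+1)) :
    v.succAbove k = Fin.last (m+1) ↔ k = Fin.last m := by
  constructor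
  · intro h
    apply Fin.succAbove_right_injective (p := v)
    rw [h, succAbove_last_aux v hv]
  · rintro rfl
    exact succAbove_last_aux v hv

lemma topOk_app {m : ℕ} (σ : Equiv.Perm (Fin (m+1))) (v : Fin (m+2)) :
    TopOk (app σ v) ↔ v ≠ Fin.last _ ∧ (v = (Fin.last m).castSucc ∨ TopOk σ) := by
  constructor
  · intro h
    have hv : v ≠ Fin.last _ := by
      rintro rfl
      exact not_served_last _ (h (Fin.last _) (app_last _ _))
    refine ⟨hv, ?_⟩
    by_cases hc : v = (Fin.last m).castSucc
    · exact Or.inl hc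
    right
    intro i hi
    have := h i.castSucc (by rw [app_castSucc, succAbove_eq_last v hv, hi])
    rw [served_castSucc] at this
    tauto
  · rintro ⟨hv, h⟩ i
    induction i using Fin.lastCases with
    | last => intro hi; rw [app_last] at hi; exact absurd hi hv
    | cast i =>
      intro hi
      rw [app_castSucc, succAbove_eq_last v hv] at hi
      rw [served_castSucc]
      rcases h with h | h
      · exact Or.inr ⟨hi, h⟩
      · exact Or.inl (h i hi)

lemma earlyOk_app {m : ℕ} (σ : Equiv.Perm (Fin (m+1))) (v : Fin (m+2)) :
    EarlyOk (app σ v) ↔ EarlyOk σ ∧ (v = Fin.last _ → TopOk σ) := by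
  have hne : (Fin.last (m+1)) ≠ (Fin.last m).castSucc := (Fin.castSucc_lt_last _).ne'
  by_cases hv : v = Fin.last _
  · subst hv
    simp only [forall_const]
    rw [← good_iff]
    constructor
    · intro h i hi
      have := h i.castSucc ((ltr_castSucc _ _ _).2 hi) (by
        rw [app_castSucc, Fin.succAbove_last]; exact (Fin.castSucc_lt_last _).ne)
      rw [served_castSucc] at this
      tauto
    · intro h i
      induction i using Fin.lastCases with
      | last => intro _ hi; rw [app_last] at hi; exact absurd rfl hi
      | cast i =>
        intro hi _
        rw [served_castSucc]
        exact Or.inl (h i ((ltr_castSucc _ _ _).1 hi))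
  · simp only [hv, false_imp_iff, and_true]
    constructor
    · intro h i hi hl
      have := h i.castSucc ((ltr_castSucc _ _ _).2 hi) (by
        rwa [app_castSucc, ne_eq, succAbove_eq_last v hv])
      rw [served_castSucc] at this
      tauto
    · intro h i
      induction i using Fin.lastCases with
      | last => intro hi; rw [ltr_last] at hi; exact absurd hi hv
      | cast i =>
        intro hi hl
        rw [app_castSucc, ne_eq, succAbove_eq_last v hv] at hl
        rw [served_castSucc]
        exact Or.inl (h i ((ltr_castSucc _ _ _).1 hi) hl)

noncomputable def cntA (m : ℕ) : ℕ :=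
  Nat.card {σ : Equiv.Perm (Fin (m+1)) // EarlyOk σ ∧ TopOk σ}

noncomputable def cntD (m : ℕ) : ℕ :=
  Nat.card {σ : Equiv.Perm (Fin (m+1)) // EarlyOk σ ∧ ¬ TopOk σ}

open Classical in
lemma count_aux {m : ℕ} (P : Equiv.Perm (Fin (m+2)) → Prop)
    (Q R : Equiv.Perm (Fin (m+1)) → Prop) (S U : Finset (Fin (m+2)))
    (hQR : ∀ σ, Q σ → ¬ R σ)
    (h : ∀ σ v, P (app σ v) ↔ (Q σ ∧ v ∈ S) ∨ (R σ ∧ v ∈ U)) :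
    Nat.card {σ // P σ} = Nat.card {σ // Q σ} * S.card + Nat.card {σ // R σ} * U.card := by
  have e : Nat.card {σ // P σ} =
      Nat.card {x : Equiv.Perm (Fin (m+1)) × Fin (m+2) // P (app x.1 x.2)} :=
    Nat.card_congr ((Equiv.ofBijective _ (app_bij (m+1))).subtypeEquiv (fun x => Iff.rfl)).symm
  rw [e]
  simp only [Nat.card_eq_fintype_card, Fintype.card_subtype]
  have : (Finset.univ.filter (fun x : Equiv.Perm (Fin (m+1)) × Fin (m+2) => P (app x.1 x.2)))
      = (Finset.univ.filter Q) ×ˢ S ∪ (Finset.univ.filter R) ×ˢ U := by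
    ext x
    simp [h]
  rw [this, Finset.card_union_of_disjoint, Finset.card_product, Finset.card_product]
  rw [Finset.disjoint_left]
  intro x hx hx'
  simp at hx hx'
  exact hQR _ hx.1 hx'.1

lemma cntA_succ (m : ℕ) : cntA (m+1) = cntA m * (m+1) + cntD m := by
  have hne : (Fin.last (m+1)) ≠ (Fin.last m).castSucc := (Fin.castSucc_lt_last _).ne'
  have := count_aux (m := m) (fun σ => EarlyOk σ ∧ TopOk σ) (fun σ => EarlyOk σ ∧ TopOk σ)
    (fun σ => EarlyOk σ ∧ ¬ TopOk σ) {Fin.last _}ᶜ {(Fin.last m).castSucc} (by tauto) (by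
      intro σ v
      rw [earlyOk_app, topOk_app]
      simp only [Finset.mem_compl, Finset.mem_singleton]
      by_cases h : v = (Fin.last m).castSucc
      · subst h; simp [hne.symm]; tauto
      · tauto)
  simpa [Finset.card_compl, cntA, cntD] using this

lemma cntD_succ (m : ℕ) : cntD (m+1) = cntA m + cntD m * m := by
  have hne : (Fin.last (m+1)) ≠ (Fin.last m).castSucc := (Fin.castSucc_lt_last _).ne'
  have := count_aux (m := m) (fun σ => EarlyOk σ ∧ ¬ TopOk σ) (fun σ => EarlyOk σ ∧ TopOk σ)
    (fun σ => EarlyOk σ ∧ ¬ TopOk σ) {Fin.last _} {Fin.last _, (Fin.last m).castSucc}ᶜ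
    (by tauto) (by
      intro σ v
      rw [earlyOk_app, topOk_app]
      simp only [Finset.mem_compl, Finset.mem_singleton, Finset.mem_insert]
      tauto)
  rw [Finset.card_compl, Finset.card_pair hne] at this
  simpa [cntA, cntD] using this

instance subs01 : Subsingleton (Fin (0+1)) := inferInstanceAs (Subsingleton (Fin 1))

lemma cntA_zero : cntA 0 = 0 := by
  unfold cntA
  rw [Nat.card_eq_zero]
  left
  constructor
  rintro ⟨σ, _, h⟩
  exact not_served_last σ (h _ (Subsingleton.elim _ _))

lemma cntD_zero : cntD 0 = 1 := by
  unfold cntD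
  rw [Nat.card_eq_one_iff_unique]
  refine ⟨⟨fun a b => Subtype.ext (Subsingleton.elim _ _)⟩, ⟨1, ?_, ?_⟩⟩
  · intro i _ h
    exact absurd (Subsingleton.elim _ _) h
  · intro h
    exact not_served_last _ (h _ (Subsingleton.elim _ _))

/-! ### `InC` -/

lemma pair_cons {α : Type*} (a b c : α) (l : List α) :
    [a, b].Sublist (c :: l) ↔ (a = c ∧ b ∈ l) ∨ [a, b].Sublist l := by
  constructor
  · intro h
    cases h with
    | cons _ h => exact Or.inr h
    | cons_cons _ h => exact Or.inl ⟨rfl, by simpa using h⟩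
  · rintro (⟨rfl, h⟩ | h)
    · exact List.Sublist.cons_cons _ (by simpa using h)
    · exact h.cons _

lemma pair_append {α : Type*} (a b : α) (l m : List α) :
    [a, b].Sublist (l ++ m) ↔ [a, b].Sublist l ∨ (a ∈ l ∧ b ∈ m) ∨ [a, b].Sublist m := by
  induction l with
  | nil => simp
  | cons c l ih =>
    rw [List.cons_append, pair_cons, pair_cons, ih]
    simp only [List.mem_append, List.mem_cons]
    tauto

lemma pair_permWord {n : ℕ} (σ : Equiv.Perm (Fin n)) (a b : Fin n) :
    [a, b].Sublist (permWord σ) ↔ σ.symm a < σ.symm b := by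
  have key : ∀ i j : Fin n, i < j → [σ i, σ j].Sublist (permWord σ) := by
    have : (List.finRange n).Pairwise (· < ·) := List.pairwise_lt_finRange n
    intro i j hij
    have hs : [i, j].Sublist (List.finRange n) := by
      rw [List.sublist_iff_exists_fin_orderEmbedding_get_eq]
      refine ⟨OrderEmbedding.ofStrictMono
        (fun k => if k.1 = 0 then (Fin.cast (by simp) i) else Fin.cast (by simp) j) ?_, ?_⟩
      · intro x y hxy
        have hx : x.1 = 0 := by have := y.2; simp at this; have : x.1 < y.1 := hxy; omega
        have hy : y.1 ≠ 0 := by have : x.1 < y.1 := hxy; omega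
        simp [hx, hy]
        exact hij
      · intro x
        have h2 := x.2
        rcases x with ⟨_ | _ | x, hx⟩
        · simp
        · simp
        · simp at hx
    have := hs.map σ
    simpa [permWord, List.ofFn_eq_map] using this
  have nd : (permWord σ).Nodup := by
    rw [permWord, List.nodup_ofFn]; exact σ.injective
  constructor
  · intro h
    by_contra hlt
    rcases (not_lt.1 hlt).lt_or_eq with h2 | h2
    · have h3 := key _ _ h2
      simp only [Equiv.apply_symm_apply] at h3
      have asym : ∀ l : List (Fin n), l.Nodup → [a, b].Sublist l → [b, a].Sublist l → False := by
        intro l hl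
        induction l with
        | nil => simp
        | cons c l ih =>
          rw [pair_cons, pair_cons]
          rw [List.nodup_cons] at hl
          have := ih hl.2
          rintro (⟨rfl, h1⟩ | h1) (⟨rfl, h2⟩ | h2)
          · exact hl.1 h1
          · exact hl.1 (h2.subset (by simp))
          · exact hl.1 (h1.subset (by simp))
          · exact this h1 h2
      exact asym _ nd h h3
    · have := σ.symm.injective h2
      subst this
      have := nd.sublist h
      simp at this
  · intro h
    simpa using key _ _ h

/-- values that are not left-to-right maxima -/
def nonL {n : ℕ} (σ : Equiv.Perm (Fin n)) : Set (Fin n) :=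
  {a | ∃ b, a < b ∧ [b, a].Sublist (permWord σ)}

lemma not_ltr_iff {n : ℕ} (σ : Equiv.Perm (Fin n)) (i : Fin n) :
    ¬ IsLtrMax σ i ↔ ∃ j, j < i ∧ σ i < σ j := by
  unfold IsLtrMax
  push Not
  constructor
  · rintro ⟨j, h1, h2⟩
    refine ⟨j, lt_of_le_of_ne h1 ?_, h2⟩
    rintro rfl
    exact lt_irrefl _ h2
  · rintro ⟨j, h1, h2⟩
    exact ⟨j, h1.le, h2⟩

lemma count_eq {n : ℕ} (σ : Equiv.Perm (Fin n)) : nonLtrMaxCount σ = (nonL σ).ncard := by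
  unfold nonLtrMaxCount
  rw [← Set.ncard_image_of_injective _ σ.injective]
  congr 1
  ext a
  simp only [Set.mem_image, Set.mem_ofPred_eq, nonL, not_ltr_iff, pair_permWord]
  constructor
  · rintro ⟨i, ⟨j, h1, h2⟩, rfl⟩
    exact ⟨σ j, h2, by simpa⟩
  · rintro ⟨b, h1, h2⟩
    exact ⟨σ.symm a, ⟨σ.symm b, h2, by simpa⟩, by simp⟩

lemma jump_pres {α : Type*} (a b c : α) (l₁ l₂ l₃ : List α) (hac : a ≠ c)
    (h : [a, b].Sublist (l₁ ++ c :: (l₂ ++ l₃))) :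
    [a, b].Sublist (l₁ ++ (l₂ ++ c :: l₃)) := by
  simp only [pair_append, pair_cons, List.mem_append, List.mem_cons] at h ⊢
  tauto

lemma reach_lower {n : ℕ} (q : ℕ) : ∀ (α σ : Equiv.Perm (Fin n)), ReachIn q α σ →
    ∃ S : Finset (Fin n), S.card ≤ q ∧ ∀ a, a ∉ S → ∀ b,
      [a, b].Sublist (permWord α) → [a, b].Sublist (permWord σ) := by
  induction q with
  | zero =>
    rintro α σ rfl
    exact ⟨∅, by simp, fun a _ b h => h⟩
  | succ q ih =>
    rintro α σ ⟨γ, ⟨l₁, l₂, l₃, c, _, h1, h2⟩, hr⟩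
    obtain ⟨S, hS, h⟩ := ih γ σ hr
    refine ⟨insert c S, (Finset.card_insert_le _ _).trans (by omega), ?_⟩
    intro a ha b hab
    simp only [Finset.mem_insert, not_or] at ha
    refine h a ha.2 b ?_
    rw [h2]
    rw [h1] at hab
    exact jump_pres a b c l₁ l₂ l₃ ha.1 hab

lemma count_le_of_reach {n : ℕ} (q : ℕ) (σ : Equiv.Perm (Fin n)) (h : ReachIn q 1 σ) :
    nonLtrMaxCount σ ≤ q := by
  obtain ⟨S, hS, h⟩ := reach_lower q 1 σ h
  rw [count_eq]
  refine le_trans ?_ hS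
  rw [← Set.ncard_coe_finset]
  apply Set.ncard_le_ncard _ S.finite_toSet
  rintro a ⟨b, hab, hs⟩
  by_contra ha
  have := h a ha b (by rw [pair_permWord]; exact hab)
  rw [pair_permWord] at this hs
  exact lt_asymm this hs

lemma reach_snoc {n : ℕ} (q : ℕ) : ∀ (α γ σ : Equiv.Perm (Fin n)), ReachIn q α γ →
    RightJump γ σ → ReachIn (q+1) α σ := by
  induction q with
  | zero => rintro α γ σ rfl h; exact ⟨σ, h, rfl⟩
  | succ q ih =>
    rintro α γ σ ⟨δ, h1, h2⟩ h
    exact ⟨δ, h1, ih δ γ σ h2 h⟩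

lemma exists_perm_of_list {n : ℕ} (L : List (Fin n)) (hn : L.Nodup) (hl : L.length = n) :
    ∃ γ : Equiv.Perm (Fin n), permWord γ = L := by
  have : Function.Bijective (fun i : Fin n => L.get (Fin.cast hl.symm i)) :=
    Finite.injective_iff_bijective.1
      ((List.nodup_iff_injective_get.1 hn).comp (Fin.cast_injective _))
  refine ⟨Equiv.ofBijective _ this, ?_⟩
  apply List.ext_getElem
  · simp [permWord, hl]
  · intro i h1 h2
    simp [permWord]

lemma exists_jump {n : ℕ} (σ : Equiv.Perm (Fin n)) (a : Fin n) (ha : a ∈ nonL σ) :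
    ∃ γ, RightJump γ σ ∧ nonL γ ⊆ nonL σ \ {a} := by
  obtain ⟨b₀, hb₀, hs⟩ := ha
  have nd : (permWord σ).Nodup := by
    rw [permWord, List.nodup_ofFn]; exact σ.injective
  have hmem : a ∈ permWord σ := hs.subset (by simp)
  obtain ⟨u, l₃, hw⟩ := List.append_of_mem hmem
  have hb₀u : b₀ ∈ u := by
    rw [hw] at hs nd
    simp only [pair_append, pair_cons, List.mem_cons] at hs
    have h1 : a ∉ u := fun h => by
      simp [List.nodup_append] at nd
      exact (nd.2.2 a h).1 rfl
    have h2 : a ∉ l₃ := by simp [List.nodup_append] at nd; exact nd.2.1.1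
    rcases hs with hs | hs | hs | hs
    · exact hs.subset (by simp)
    · exact hs.1
    · exact absurd hs.2 h2
    · exact absurd (hs.subset (by simp)) h2
  obtain ⟨l₁, b, l₂, hu, hl₁, hb⟩ : ∃ l₁ b l₂, u = l₁ ++ b :: l₂ ∧ (∀ x ∈ l₁, x ≤ a) ∧ a < b := by
    clear hw
    induction u with
    | nil => simp at hb₀u
    | cons c u ih =>
      by_cases hc : a < c
      · exact ⟨[], c, u, rfl, by simp, hc⟩
      · have : b₀ ∈ u := by
          rcases List.mem_cons.1 hb₀u with rfl | h
          · exact absurd hb₀ hc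
          · exact h
        obtain ⟨l₁, b, l₂, rfl, h1, h2⟩ := ih this
        refine ⟨c :: l₁, b, l₂, rfl, ?_, h2⟩
        intro x hx
        rcases List.mem_cons.1 hx with rfl | h
        · exact not_lt.1 hc
        · exact h1 x h
  subst hu
  have hw' : permWord σ = l₁ ++ ((b :: l₂) ++ a :: l₃) := by rw [hw]; simp
  have hperm : (l₁ ++ a :: ((b :: l₂) ++ l₃)).Perm (permWord σ) := by
    rw [hw']
    exact List.Perm.append_left _ List.perm_middle.symm
  have hnd := hperm.nodup_iff.2 nd
  obtain ⟨γ, hγ⟩ := exists_perm_of_list (l₁ ++ a :: ((b :: l₂) ++ l₃))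
    hnd (by rw [hperm.length_eq]; simp [permWord])
  refine ⟨γ, ⟨l₁, b :: l₂, l₃, a, by simp, hγ, hw'⟩, ?_⟩
  have hna : a ∉ b :: l₂ ++ l₃ := by
    have := (List.nodup_append.1 hnd).2.1
    exact (List.nodup_cons.1 this).1
  have hna1 : a ∉ l₁ := by
    intro h
    exact (List.nodup_append.1 hnd).2.2 a h a (by simp) rfl
  rintro x ⟨y, hxy, hs⟩
  rw [hγ] at hs
  have hxa : x ≠ a := by
    rintro rfl
    rw [pair_append, pair_cons] at hs
    rcases hs with hs | hs | hs | hs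
    · exact hna1 (hs.subset (by simp))
    · exact absurd (hl₁ _ hs.1) (not_le.2 hxy)
    · exact hna hs.2
    · exact hna (hs.subset (by simp))
  refine ⟨?_, hxa⟩
  by_cases hya : y = a
  · subst hya
    refine ⟨b, hxy.trans hb, ?_⟩
    rw [hw']
    rw [pair_append, pair_cons] at hs
    have hx : x ∈ b :: l₂ ++ l₃ := by
      rcases hs with hs | hs | hs | hs
      · exact absurd (hs.subset (by simp)) hna1
      · exact absurd hs.1 hna1
      · exact hs.2
      · exact hs.subset (by simp)
    have hxb : x ≠ b := (hxy.trans hb).ne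
    simp only [List.cons_append, List.mem_cons, List.mem_append, pair_append, pair_cons] at hx ⊢
    tauto
  · refine ⟨y, hxy, ?_⟩
    rw [hw']
    exact jump_pres y x a l₁ (b :: l₂) l₃ hya hs

lemma reach_of_count {n : ℕ} (k : ℕ) : ∀ σ : Equiv.Perm (Fin n), (nonL σ).ncard ≤ k →
    ∃ q ≤ k, ReachIn q 1 σ := by
  induction k with
  | zero =>
    intro σ h
    refine ⟨0, le_rfl, ?_⟩
    have h0 : nonL σ = ∅ := (Set.ncard_eq_zero (Set.toFinite _)).1 (by omega)
    have hm : StrictMono σ := by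
      intro i j hij
      by_contra hlt
      have hne : σ j ≠ σ i := fun h => hij.ne' (σ.injective h)
      have : σ j ∈ nonL σ := ⟨σ i, lt_of_le_of_ne (not_lt.1 hlt) hne, by
        rw [pair_permWord]; simpa using hij⟩
      rw [h0] at this
      exact this
    show 1 = σ
    have := StrictMono.range_inj (f := σ) (g := (1 : Equiv.Perm (Fin n))) hm strictMono_id
    exact (DFunLike.coe_injective (this.1
      (by rw [σ.surjective.range_eq, (1 : Equiv.Perm (Fin n)).surjective.range_eq]))).symm
  | succ k ih =>
    intro σ h
    by_cases h0 : (nonL σ).Nonempty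
    · obtain ⟨a, ha⟩ := h0
      obtain ⟨γ, hj, hs⟩ := exists_jump σ a ha
      have h1 := Set.ncard_le_ncard hs (Set.toFinite _)
      have h2 := Set.ncard_sdiff_singleton_add_one ha (Set.toFinite _)
      obtain ⟨q, hq, hr⟩ := ih γ (by omega)
      exact ⟨q+1, by omega, reach_snoc q 1 γ σ hr hj⟩
    · rw [Set.not_nonempty_iff_eq_empty] at h0
      obtain ⟨q, hq, hr⟩ := ih σ (by simp [h0])
      exact ⟨q, by omega, hr⟩

lemma inC_iff {n : ℕ} (p : ℕ) (σ : Equiv.Perm (Fin n)) : InC p σ ↔ nonLtrMaxCount σ ≤ p := by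
  constructor
  · rintro ⟨q, hq, h⟩
    exact (count_le_of_reach q σ h).trans hq
  · intro h
    exact reach_of_count p σ (by rwa [← count_eq])

/-! ### the basis -/

lemma exists_del {m : ℕ} (σ : Equiv.Perm (Fin (m+1))) (i : Fin (m+1)) :
    ∃ π : Equiv.Perm (Fin m), ∀ j, (σ i).succAbove (π j) = σ (i.succAbove j) := by
  have h : ∀ j, ∃ k, (σ i).succAbove k = σ (i.succAbove j) := fun j =>
    Fin.exists_succAbove_eq (fun h => Fin.succAbove_ne i j (σ.injective h))
  choose f hf using h
  have hinj : Function.Injective f := by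
    intro x y hxy
    have h1 := hf x
    rw [hxy, hf y] at h1
    exact (Fin.succAbove_right_injective (σ.injective h1)).symm
  exact ⟨Equiv.ofBijective f (Finite.injective_iff_bijective.1 hinj), hf⟩

lemma inBasis_iff {n : ℕ} (p : ℕ) (σ : Equiv.Perm (Fin n)) :
    InBasis p σ ↔ nonLtrMaxCount σ = p + 1 ∧ Good σ := by
  constructor
  · rintro ⟨h1, h2⟩
    rw [inC_iff] at h1
    push Not at h1
    cases n with
    | zero =>
      exfalso
      unfold nonLtrMaxCount at h1
      rw [Set.eq_empty_of_isEmpty {i | ¬ IsLtrMax σ i}] at h1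
      simp at h1
    | succ m =>
    have key : ∀ i, ∃ π : Equiv.Perm (Fin m), nonLtrMaxCount π ≤ p ∧
        ∀ j, (σ i).succAbove (π j) = σ (i.succAbove j) := by
      intro i
      obtain ⟨π, hπ⟩ := exists_del σ i
      refine ⟨π, ?_, hπ⟩
      rw [← inC_iff]
      refine h2 m π ⟨i.succAbove, Fin.strictMono_succAbove i, fun x y => ?_⟩ (by omega)
      rw [← hπ, ← hπ, Fin.succAbove_lt_succAbove_iff]
    have key2 : ∀ i, ∀ π : Equiv.Perm (Fin m),
        (∀ j, (σ i).succAbove (π j) = σ (i.succAbove j)) →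
        ∀ j k, j ≠ i → k ≠ i → k < j → σ j < σ k →
        j ∈ i.succAbove '' {x | ¬ IsLtrMax π x} := by
      intro i π hπ j k hj hk hkj hlt
      obtain ⟨j, rfl⟩ := Fin.exists_succAbove_eq hj
      obtain ⟨k, rfl⟩ := Fin.exists_succAbove_eq hk
      refine ⟨j, (not_ltr_iff _ _).2 ⟨k, ?_, ?_⟩, rfl⟩
      · rwa [Fin.succAbove_lt_succAbove_iff] at hkj
      · rwa [← hπ, ← hπ, Fin.succAbove_lt_succAbove_iff] at hlt
    have good : Good σ := by
      intro i hi
      by_contra hns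
      obtain ⟨π, hc, hπ⟩ := key i
      have hsub : {x | ¬ IsLtrMax σ x} ⊆ i.succAbove '' {x | ¬ IsLtrMax π x} := by
        intro j hj
        have hji : j ≠ i := by rintro rfl; exact hj hi
        obtain ⟨k, hk1, hk2⟩ := (not_ltr_iff _ _).1 hj
        by_cases hki : k = i
        · subst hki
          have : ¬ ∀ l, l < j → σ j < σ l → l = k := fun h => hns ⟨j, hk1, hk2, h⟩
          push Not at this
          obtain ⟨l, hl1, hl2, hl3⟩ := this
          exact key2 k π hπ j l hji hl3 hl1 hl2
        · exact key2 i π hπ j k hji hki hk1 hk2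
      have := Set.ncard_le_ncard hsub (Set.toFinite _)
      rw [Set.ncard_image_of_injective _ Fin.succAbove_right_injective] at this
      unfold nonLtrMaxCount at h1 hc
      omega
    refine ⟨?_, good⟩
    have hne : {x | ¬ IsLtrMax σ x}.Nonempty := by
      rw [Set.nonempty_iff_ne_empty]
      intro h
      unfold nonLtrMaxCount at h1
      rw [h] at h1
      simp at h1
    obtain ⟨i, hi⟩ := hne
    obtain ⟨π, hc, hπ⟩ := key i
    have hsub : {x | ¬ IsLtrMax σ x} ⊆ insert i (i.succAbove '' {x | ¬ IsLtrMax π x}) := by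
      intro j hj
      by_cases hji : j = i
      · exact Or.inl hji
      right
      obtain ⟨k, hk1, hk2⟩ := (not_ltr_iff _ _).1 hj
      by_cases hki : k = i
      · subst hki
        obtain ⟨l, hl1, hl2⟩ := (not_ltr_iff _ _).1 hi
        exact key2 k π hπ j l hji hl1.ne (hl1.trans hk1) (hk2.trans hl2)
      · exact key2 i π hπ j k hji hki hk1 hk2
    have h3 := Set.ncard_le_ncard hsub (Set.toFinite _)
    have h4 := Set.ncard_insert_le i (i.succAbove '' {x | ¬ IsLtrMax π x})
    rw [Set.ncard_image_of_injective _ Fin.succAbove_right_injective] at h4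
    unfold nonLtrMaxCount at *
    omega
  · rintro ⟨h1, h2⟩
    refine ⟨by rw [inC_iff]; omega, ?_⟩
    rintro k π ⟨f, hf, hfπ⟩ hk
    rw [inC_iff]
    have hsub : f '' {x | ¬ IsLtrMax π x} ⊆ {x | ¬ IsLtrMax σ x} := by
      rintro _ ⟨x, hx, rfl⟩
      obtain ⟨y, hy1, hy2⟩ := (not_ltr_iff _ _).1 hx
      exact (not_ltr_iff _ _).2 ⟨f y, hf hy1, (hfπ _ _).1 hy2⟩
    have hnr : ∃ i, i ∉ Set.range f := by
      by_contra h
      push Not at h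
      have := Fintype.card_of_bijective (f := f) ⟨hf.injective, h⟩
      simp at this
      exact hk this
    obtain ⟨i, hi⟩ := hnr
    have hmiss : ∃ t, t ∈ {x | ¬ IsLtrMax σ x} ∧ t ∉ f '' {x | ¬ IsLtrMax π x} := by
      by_cases hl : IsLtrMax σ i
      · obtain ⟨t, ht1, ht2, ht3⟩ := h2 i hl
        refine ⟨t, (not_ltr_iff _ _).2 ⟨i, ht1, ht2⟩, ?_⟩
        rintro ⟨x, hx, rfl⟩
        obtain ⟨y, hy1, hy2⟩ := (not_ltr_iff _ _).1 hx
        exact hi ⟨y, ht3 (f y) (hf hy1) ((hfπ _ _).1 hy2)⟩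
      · exact ⟨i, hl, fun ⟨x, _, hx⟩ => hi ⟨x, hx⟩⟩
    obtain ⟨t, ht1, ht2⟩ := hmiss
    have := Set.ncard_lt_ncard (Set.ssubset_iff_of_subset hsub |>.2 ⟨t, ht1, ht2⟩) (Set.toFinite _)
    rw [Set.ncard_image_of_injective _ hf.injective] at this
    unfold nonLtrMaxCount at *
    omega

lemma bTotal_zero : bTotal 0 = 0 := by
  unfold bTotal
  apply Finset.sum_eq_zero
  intro p _
  unfold bnp
  rw [Nat.card_eq_zero]
  left
  constructor
  rintro ⟨σ, h⟩
  have h1 := ((inBasis_iff p σ).1 h).1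
  unfold nonLtrMaxCount at h1
  rw [Set.eq_empty_of_isEmpty {i | ¬ IsLtrMax σ i}] at h1
  simp at h1

open Classical in
lemma bTotal_succ (m : ℕ) : bTotal (m+1) = cntA m := by
  unfold bTotal cntA bnp
  simp only [inBasis_iff, ← good_iff, Nat.card_eq_fintype_card, Fintype.card_subtype]
  rw [← Finset.card_biUnion]
  · congr 1
    ext σ
    simp only [Finset.mem_biUnion, Finset.mem_range, Finset.mem_filter, Finset.mem_univ, true_and]
    constructor
    · rintro ⟨p, _, _, h⟩; exact h
    · intro h
      have h0 : IsLtrMax σ 0 := by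
        intro j hj
        rw [Fin.le_zero_iff.1 hj]
      obtain ⟨t, ht1, ht2, _⟩ := h 0 h0
      have hpos : 0 < nonLtrMaxCount σ := by
        unfold nonLtrMaxCount
        rw [Set.ncard_pos (Set.toFinite _)]
        exact ⟨t, (not_ltr_iff _ _).2 ⟨0, ht1, ht2⟩⟩
      have hle : nonLtrMaxCount σ ≤ m + 1 := by
        unfold nonLtrMaxCount
        have := Set.ncard_le_ncard (Set.subset_univ {i | ¬ IsLtrMax σ i}) (Set.toFinite _)
        simpa [Set.ncard_univ] using this
      exact ⟨nonLtrMaxCount σ - 1, by omega, by omega, h⟩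
  · intro p _ q _ hpq
    rw [Function.onFun, Finset.disjoint_left]
    intro σ h1 h2
    simp only [Finset.mem_filter, Finset.mem_univ, true_and] at h1 h2
    omega

/-- the numbers `bₙ` satisfy `b₀ = b₁ = 0`, `b₂ = 1` and, for `n ≥ 1`,
`b_{n+2} = 2n·b_{n+1} + (1+n−n²)·bₙ`. -/
theorem bTotal_recurrence :
    bTotal 0 = 0 ∧ bTotal 1 = 0 ∧ bTotal 2 = 1 ∧
    ∀ n : ℕ, 1 ≤ n →
      (bTotal (n + 2) : ℤ) =
        2 * (n : ℤ) * (bTotal (n + 1) : ℤ) +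
          (1 + (n : ℤ) - (n : ℤ) ^ 2) * (bTotal n : ℤ) := by
  refine ⟨bTotal_zero, ?_, ?_, ?_⟩
  · rw [bTotal_succ, cntA_zero]
  · rw [bTotal_succ, cntA_succ, cntA_zero, cntD_zero]
  · intro n hn
    obtain ⟨m, rfl⟩ : ∃ m, n = m + 1 := ⟨n - 1, by omega⟩
    rw [bTotal_succ, bTotal_succ, bTotal_succ, cntA_succ (m+1), cntD_succ, cntA_succ]
    push_cast
    ring
end

section
/- Let φ = (1+√5)/2 be the golden ratio. Then bₙ/n! is asymptotically equivalent, as n → ∞, to (φ / (√5 · Γ(φ−1))) · n^{φ−2}, where Γ is the Euler gamma function. In particular, the probability that a uniformly random permutation of length n is a basis permutation tends to 0 only polynomially in n, with algebraic irrational exponent φ−2. -/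
/-- The sequence `bₙ` (number of basis permutations of length `n`), defined by
`b₀ = b₁ = 0`, `b₂ = 1`, and `b_{n+2} = 2n·b_{n+1} + (1+n−n²)·bₙ` for `n ≥ 1`. -/
def bseq : ℕ → ℤ
  | 0 => 0
  | 1 => 0
  | 2 => 1
  | n + 3 =>
      2 * ((n : ℤ) + 1) * bseq (n + 2) +
        (1 + ((n : ℤ) + 1) - ((n : ℤ) + 1) ^ 2) * bseq (n + 1)

open Asymptotics Filter in
theorem rising_tendsto (s : ℝ) (hs : Real.Gamma s ≠ 0) (h0 : ∀ n : ℕ, s + n ≠ 0) :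
    Tendsto (fun n : ℕ => (∏ j ∈ Finset.range n, (s + (j : ℝ))) / (n.factorial : ℝ) /
      (n : ℝ) ^ (s - 1)) atTop (nhds (1 / Real.Gamma s)) := by
  have h1 := (Real.GammaSeq_tendsto_Gamma s).inv₀ hs
  have h2 : Tendsto (fun n : ℕ => (1 + s / (n : ℝ))⁻¹) atTop (nhds ((1 + 0)⁻¹)) :=
    (tendsto_const_nhds.add (tendsto_const_div_atTop_nhds_zero_nat s)).inv₀ (by norm_num)
  have h3 := h1.mul h2
  have e : (Real.Gamma s)⁻¹ * (1 + 0 : ℝ)⁻¹ = 1 / Real.Gamma s := by simp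
  rw [e] at h3
  refine h3.congr' ?_
  filter_upwards [eventually_ge_atTop 1] with n hn
  have hn0 : (0 : ℝ) < n := by exact_mod_cast hn
  have hf : (n.factorial : ℝ) ≠ 0 := by exact_mod_cast n.factorial_ne_zero
  have hp : (n : ℝ) ^ s ≠ 0 := (Real.rpow_pos_of_pos hn0 s).ne'
  have hsn := h0 n
  have hsn' : (n : ℝ) + s ≠ 0 := by rwa [add_comm]
  rw [Real.GammaSeq, Finset.prod_range_succ, Real.rpow_sub hn0, Real.rpow_one]
  have : (1 + s / (n : ℝ)) = (s + n) / n := by field_simp; ring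
  rw [this]
  field_simp

theorem bseq_closed (p α β : ℝ) (hp : p ^ 2 = p + 1) (hab : α + β = 1)
    (h1 : α * (-p) + β * (p - 1) = 0) (n : ℕ) :
    (bseq (n + 1) : ℝ) = α * ∏ j ∈ Finset.range (n + 1), (-p + (j : ℝ)) +
      β * ∏ j ∈ Finset.range (n + 1), (p - 1 + (j : ℝ)) := by
  induction n using Nat.strong_induction_on with
  | _ n ih =>
    match n, ih with
    | 0, _ => simp [bseq]; linarith
    | 1, _ =>
      simp [bseq, Finset.prod_range_succ]
      linear_combination (-1 : ℝ) * hab - (α + β) * hp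
    | n + 2, ih =>
      have a := ih n (by omega)
      have b := ih (n + 1) (by omega)
      rw [show n + 2 + 1 = n + 3 from rfl, bseq]
      push_cast
      rw [show n + 2 = n + 1 + 1 from rfl, b, a]
      rw [show n + 3 = n + 1 + 1 + 1 from rfl]
      simp only [Finset.prod_range_succ _ (n + 1 + 1), Finset.prod_range_succ _ (n + 1)]
      push_cast
      linear_combination (-(α * ∏ j ∈ Finset.range (n + 1), (-p + (j : ℝ))) -
        (β * ∏ j ∈ Finset.range (n + 1), (p - 1 + (j : ℝ)))) * hp

open Asymptotics Filter in
/-- with `φ = (1+√5)/2` the golden ratio,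
`bₙ/n! ∼ (φ/(√5·Γ(φ−1)))·n^{φ−2}` as `n → ∞`. -/
theorem bseq_asymptotics :
    (fun n : ℕ => (bseq n : ℝ) / (n.factorial : ℝ)) ~[atTop]
      (fun n : ℕ =>
        ((1 + Real.sqrt 5) / 2) /
            (Real.sqrt 5 * Real.Gamma ((1 + Real.sqrt 5) / 2 - 1)) *
          (n : ℝ) ^ ((1 + Real.sqrt 5) / 2 - 2)) := by
  have h5 : Real.sqrt 5 ^ 2 = 5 := Real.sq_sqrt (by norm_num)
  have h5p : 0 < Real.sqrt 5 := Real.sqrt_pos.mpr (by norm_num)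
  generalize hr : Real.sqrt 5 = r at *
  obtain ⟨p, hpdef⟩ : ∃ p : ℝ, p = (1 + r) / 2 := ⟨_, rfl⟩
  rw [← hpdef]
  have hrp : r = 2 * p - 1 := by linarith
  have hp : p ^ 2 = p + 1 := by rw [hpdef]; linear_combination h5 / 4
  have hp1 : 1 < p := by nlinarith
  have hp2 : p < 2 := by nlinarith
  have hG : 0 < Real.Gamma (p - 1) := Real.Gamma_pos_of_pos (by linarith)
  have hne : ∀ n : ℕ, -p + n ≠ 0 := by
    intro n hn
    have a : (1 : ℝ) < n := by linarith
    have b : (n : ℝ) < 2 := by linarith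
    have a' : 1 < n := by exact_mod_cast a
    have b' : n < 2 := by exact_mod_cast b
    omega
  have hG2 : Real.Gamma (-p) ≠ 0 :=
    Real.Gamma_ne_zero fun m h => hne m (by rw [h]; ring)
  have t1 := rising_tendsto (p - 1) hG.ne' (fun n => by
    have : (0 : ℝ) ≤ n := n.cast_nonneg
    exact (show 0 < p - 1 + (n : ℝ) by linarith).ne')
  have t2 := rising_tendsto (-p) hG2 hne
  have t3 : Tendsto (fun n : ℕ => (n : ℝ) ^ (-r)) atTop (nhds 0) :=
    (tendsto_rpow_neg_atTop h5p).comp tendsto_natCast_atTop_atTop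
  have t4 := ((t2.mul t3).const_mul ((p - 1) / r)).add (t1.const_mul (p / r))
  have hc : p / (r * Real.Gamma (p - 1)) ≠ 0 := by positivity
  have t5 := t4.div_const (p / (r * Real.Gamma (p - 1)))
  rw [isEquivalent_iff_tendsto_one]
  · have e : (((p - 1) / r * (1 / Real.Gamma (-p) * 0) + p / r * (1 / Real.Gamma (p - 1))) /
        (p / (r * Real.Gamma (p - 1)))) = 1 := by
      have := hG.ne'
      field_simp
      ring
    rw [e] at t5
    refine t5.congr' ?_
    filter_upwards [eventually_ge_atTop 1] with n hn
    obtain ⟨m, rfl⟩ : ∃ m, n = m + 1 := ⟨n - 1, by omega⟩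
    have hcl := bseq_closed p ((p - 1) / r) (p / r) hp
      (by field_simp; linarith) (by field_simp; ring) m
    have hn0 : (0 : ℝ) < ((m + 1 : ℕ) : ℝ) := by positivity
    rw [Pi.div_apply, hcl]
    have hx : (((m + 1 : ℕ) : ℝ)) ^ (-r) = ((m + 1 : ℕ) : ℝ) ^ (-p - 1) / ((m + 1 : ℕ) : ℝ) ^ (p - 2) := by
      rw [← Real.rpow_sub hn0]; congr 1; rw [hrp]; ring
    rw [hx, show p - 1 - 1 = p - 2 by ring]
    have k1 := (Real.rpow_pos_of_pos hn0 (-p - 1)).ne'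
    have k2 := (Real.rpow_pos_of_pos hn0 (p - 2)).ne'
    have k3 := hG.ne'
    have hf : ((m + 1).factorial : ℝ) ≠ 0 := by exact_mod_cast (m + 1).factorial_ne_zero
    generalize (((m + 1 : ℕ) : ℝ)) ^ (-p - 1) = A at *
    generalize (((m + 1 : ℕ) : ℝ)) ^ (p - 2) = B at *
    field_simp
  · filter_upwards [eventually_ge_atTop 1] with n hn
    have hn0 : (0 : ℝ) < n := by exact_mod_cast hn
    exact mul_ne_zero hc (Real.rpow_pos_of_pos hn0 _).ne'
end

section
/- Let m ≥ 1 and r ≥ 1 be integers, let P₀, P₁, …, P_r be polynomials with integer coefficients, and let (uₙ) be an integer sequence satisfying the P-recurrence P₀(n)·uₙ = Σ_{i=1}^{r} Pᵢ(n)·u_{n−i} for all n ≥ r. Suppose there exists N such that gcd(P₀(n), m) = 1 for all n ≥ N. Then the sequence (uₙ mod m) is ultimately periodic: there exist integers p ≥ 1 and N' such that u_{n+p} ≡ uₙ (mod m) for all n ≥ N'. -/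
/-- let `(uₙ)` be an integer sequence satisfying a P-recurrence of order `r`,
`P₀(n)·uₙ = Σ_{i=1}^r Pᵢ(n)·u_{n−i}` for `n ≥ r`. If `gcd(P₀(n), m) = 1` for all large
enough `n`, then `(uₙ mod m)` is ultimately periodic. -/
theorem pRecursive_ultimately_periodic (m r : ℕ) (hm : 1 ≤ m) (hr : 1 ≤ r)
    (P : ℕ → Polynomial ℤ) (u : ℕ → ℤ)
    (hrec : ∀ n : ℕ, r ≤ n →
      (P 0).eval (n : ℤ) * u n = ∑ i ∈ Finset.Icc 1 r, (P i).eval (n : ℤ) * u (n - i))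
    (hcop : ∃ N : ℕ, ∀ n : ℕ, N ≤ n → Int.gcd ((P 0).eval (n : ℤ)) (m : ℤ) = 1) :
    ∃ p : ℕ, 1 ≤ p ∧ ∃ N' : ℕ, ∀ n : ℕ, N' ≤ n → u (n + p) ≡ u n [ZMOD (m : ℤ)] := by
  obtain ⟨N, hN⟩ := hcop
  haveI : NeZero m := ⟨by omega⟩
  let f : ℕ → ZMod m × (Fin r → ZMod m) := fun k =>
    (((k + N : ℕ) : ZMod m), fun i => ((u (k + N + i) : ℤ) : ZMod m))
  obtain ⟨a, b, hab, hf⟩ : ∃ a b, a < b ∧ f a = f b := by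
    obtain ⟨a, b, hne, hf⟩ := Finite.exists_ne_map_eq_of_infinite f
    rcases lt_or_gt_of_ne hne with h | h
    · exact ⟨a, b, h, hf⟩
    · exact ⟨b, a, h, hf.symm⟩
  have h1 : ((a + N : ℕ) : ZMod m) = ((b + N : ℕ) : ZMod m) := congrArg Prod.fst hf
  have h2 : ∀ i : Fin r, ((u (a + N + i) : ℤ) : ZMod m) = ((u (b + N + i) : ℤ) : ZMod m) :=
    fun i => congrFun (congrArg Prod.snd hf) i
  have h1' : ((a + N : ℕ) : ℤ) ≡ ((b + N : ℕ) : ℤ) [ZMOD (m : ℤ)] := by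
    rw [← ZMod.intCast_eq_intCast_iff]
    exact_mod_cast h1
  have key : ∀ j : ℕ, u (a + N + j) ≡ u (b + N + j) [ZMOD (m : ℤ)] := by
    intro j
    induction j using Nat.strong_induction_on with
    | _ j ih =>
      by_cases hj : j < r
      · exact (ZMod.intCast_eq_intCast_iff _ _ _).1 (h2 ⟨j, hj⟩)
      · have hn : ((a + N + j : ℕ) : ℤ) ≡ ((b + N + j : ℕ) : ℤ) [ZMOD (m : ℤ)] := by
          rw [Nat.cast_add (a + N), Nat.cast_add (b + N)]
          exact h1'.add_right _
        have hP : ∀ i, (P i).eval ((a + N + j : ℕ) : ℤ) ≡ (P i).eval ((b + N + j : ℕ) : ℤ)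
            [ZMOD (m : ℤ)] := fun i =>
          Int.modEq_iff_dvd.2 ((Int.modEq_iff_dvd.1 hn).trans (Polynomial.sub_dvd_eval_sub _ _ _))
        have hs : (P 0).eval ((a + N + j : ℕ) : ℤ) * u (a + N + j) ≡
            (P 0).eval ((b + N + j : ℕ) : ℤ) * u (b + N + j) [ZMOD (m : ℤ)] := by
          rw [hrec _ (by omega), hrec _ (by omega)]
          apply Int.modEq_iff_dvd.2
          rw [← Finset.sum_sub_distrib]
          apply Finset.dvd_sum
          intro i hi
          rw [Finset.mem_Icc] at hi
          apply Int.modEq_iff_dvd.1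
          refine (hP i).mul ?_
          rw [show a + N + j - i = a + N + (j - i) by omega,
            show b + N + j - i = b + N + (j - i) by omega]
          exact ih _ (by omega)
        have ht := hs.trans ((hP 0).symm.mul_right _)
        have hg := hN (a + N + j) (by omega)
        rw [Int.modEq_iff_dvd, ← mul_sub] at ht
        rw [Int.modEq_iff_dvd]
        exact (Int.isCoprime_iff_gcd_eq_one.2 hg).symm.dvd_of_dvd_mul_left ht
  refine ⟨b - a, by omega, a + N, fun n hn => ?_⟩
  have := key (n - (a + N))
  rw [show a + N + (n - (a + N)) = n by omega,
    show b + N + (n - (a + N)) = n + (b - a) by omega] at this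
  exact this.symm
end

section
/- The sequence (bₙ mod 15) is periodic of period 12 from n = 9 onwards: for all n ≥ 9, b_{n+12} ≡ bₙ (mod 15), and the residues (b₉, b₁₀, …, b₂₀) modulo 15 are (10, 5, 10, 10, 0, 10, 5, 10, 5, 5, 0, 5). -/
theorem bseq_rec (n : ℕ) : bseq (n + 3) = 2 * ((n : ℤ) + 1) * bseq (n + 2) +
        (1 + ((n : ℤ) + 1) - ((n : ℤ) + 1) ^ 2) * bseq (n + 1) := by
  rw [bseq]

theorem bseq_five (n : ℕ) : (5 : ℤ) ∣ bseq (n + 9) ∧ (5 : ℤ) ∣ bseq (n + 10) := by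
  induction n with
  | zero => constructor <;> norm_num [bseq]
  | succ k ih =>
    obtain ⟨h1, h2⟩ := ih
    rw [show k + 1 + 9 = k + 10 by ring, show k + 1 + 10 = (k + 8) + 3 by ring]
    refine ⟨h2, ?_⟩
    rw [bseq_rec]
    exact dvd_add (Dvd.dvd.mul_left h2 _) (Dvd.dvd.mul_left h1 _)

theorem bseq_three (n : ℕ) : (3 : ℤ) ∣ bseq (n + 21) - bseq (n + 9) ∧
    (3 : ℤ) ∣ bseq (n + 22) - bseq (n + 10) := by
  induction n with
  | zero => constructor <;> norm_num [bseq]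
  | succ k ih =>
    obtain ⟨⟨a, h1⟩, ⟨b, h2⟩⟩ := ih
    rw [show k + 1 + 21 = k + 22 by ring, show k + 1 + 9 = k + 10 by ring,
      show k + 1 + 22 = (k + 20) + 3 by ring, show k + 1 + 10 = (k + 8) + 3 by ring]
    refine ⟨⟨b, h2⟩, ?_⟩
    rw [bseq_rec (k + 20), bseq_rec (k + 8)]
    simp only [Nat.add_assoc, Nat.reduceAdd]
    rw [show bseq (k + 22) = bseq (k + 10) + 3 * b by linarith,
      show bseq (k + 21) = bseq (k + 9) + 3 * a by linarith]
    push_cast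
    refine ⟨8 * bseq (k + 10) + 2 * ((k : ℤ) + 21) * b
      + (1 + ((k : ℤ) + 21) - ((k : ℤ) + 21) ^ 2) * a
      + (4 - 4 * (2 * (k : ℤ) + 30)) * bseq (k + 9), ?_⟩
    ring

/-- `(bₙ mod 15)` is periodic of period `12` from `n = 9` on, with residues
`(b₉,…,b₂₀) mod 15 = (10, 5, 10, 10, 0, 10, 5, 10, 5, 5, 0, 5)`. -/
theorem bseq_mod_fifteen :
    (∀ n : ℕ, 9 ≤ n → bseq (n + 12) ≡ bseq n [ZMOD 15]) ∧
    bseq 9 % 15 = 10 ∧ bseq 10 % 15 = 5 ∧ bseq 11 % 15 = 10 ∧ bseq 12 % 15 = 10 ∧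
    bseq 13 % 15 = 0 ∧ bseq 14 % 15 = 10 ∧ bseq 15 % 15 = 5 ∧ bseq 16 % 15 = 10 ∧
    bseq 17 % 15 = 5 ∧ bseq 18 % 15 = 5 ∧ bseq 19 % 15 = 0 ∧ bseq 20 % 15 = 5 := by
  refine ⟨?_, ?_⟩
  · intro n hn
    obtain ⟨m, rfl⟩ := Nat.exists_eq_add_of_le' hn
    have h3 := (bseq_three m).1
    have h5 := (bseq_five m).1
    have h5' := (bseq_five (m + 12)).1
    rw [show m + 12 + 9 = m + 21 by ring] at h5'
    rw [show m + 9 + 12 = m + 21 by ring, Int.ModEq]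
    omega
  · norm_num [bseq]
end
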